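/- Assume (A1): f,g:[0,1]×ℝ²→ℝ are continuous and there exist L₁,L₂>0 with |f(t,x₁,y₁)−f(t,x₂,y₂)| ≤ L₁(|x₁−x₂|+|y₁−y₂|) and |g(t,x₁,y₁)−g(t,x₂,y₂)| ≤ L₂(|x₁−x₂|+|y₁−y₂|) for all t∈[0,1] and x₁,x₂,y₁,y₂∈ℝ. Set M₁ = sup_t |f(t,0,0)|, M₂ = sup_t |g(t,0,0)|, γ₁ = (M₁/Γ(α+1))[(ψ(1)−ψ(0))^α + ((λ+1)/|Δ₁|)(ψ(1)−ψ(0))^{α+1}], γ₂ = (M₂/Γ(β+1))[(ψ(1)−ψ(0))^β + ((μ+1)/|Δ₂|)(ψ(1)−ψ(0))^{β+1}], γ₃ = (L₁/Γ(α+1))[(ψ(1)−ψ(0))^α + ((λ+1)/|Δ₁|)(ψ(1)−ψ(0))^{α+1}], γ₄ = (L₂/Γ(β+1))[(ψ(1)−ψ(0))^β + ((μ+1)/|Δ₂|)(ψ(1)−ψ(0))^{β+1}]. If γ₃+γ₄<1 and r ≥ (γ₁+γ₂)/(1−(γ₃+γ₄)), then for all continuous x,y:[0,1]→ℝ with ‖x‖+‖y‖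 ≤ r one has ‖T₁(x,y)‖ + ‖T₂(x,y)‖ ≤ r; that is, the operator T = (T₁,T₂) maps the closed ball of radius r in C([0,1],ℝ)×C([0,1],ℝ) into itself. -/

import Mathlib

open MeasureTheory intervalIntegral Set

/-- The sup norm of a function on `[0,1]`. -/
noncomputable def supNorm (x : ℝ → ℝ) : ℝ := ⨆ t : Set.Icc (0:ℝ) 1, |x ↑t|

/-- The operator `T₁` (and, with the parameters `(β, ξ, μ, Δ₂, g)`, the operator `T₂`)
associated with the four-point boundary value problem:
`T₁(x,y)(t) = (1/Γ(α)) ∫₀ᵗ ψ'(s)(ψ(t)−ψ(s))^{α−1} f(s,x(s),y(s)) ds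
  + (1/Δ₁)[ (1/Γ(α)) ∫₀¹ ψ'(s)(ψ(1)−ψ(s))^{α−1} f(s,x(s),y(s)) ds
  − (λ/Γ(α)) ∫₀^η ψ'(s)(ψ(η)−ψ(s))^{α−1} f(s,x(s),y(s)) ds ] (ψ(t)−ψ(0))`. -/
noncomputable def Tmap (ψ : ℝ → ℝ) (α η lam Δ : ℝ) (f : ℝ → ℝ → ℝ → ℝ)
    (x y : ℝ → ℝ) (t : ℝ) : ℝ :=
  (1 / Real.Gamma α) * (∫ s in (0:ℝ)..t, deriv ψ s * (ψ t - ψ s) ^ (α - 1) * f s (x s) (y s))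
  + (1 / Δ) *
      ((1 / Real.Gamma α) *
          (∫ s in (0:ℝ)..1, deriv ψ s * (ψ 1 - ψ s) ^ (α - 1) * f s (x s) (y s))
        - (lam / Real.Gamma α) *
          (∫ s in (0:ℝ)..η, deriv ψ s * (ψ η - ψ s) ^ (α - 1) * f s (x s) (y s)))
    * (ψ t - ψ 0)

/-- A function continuous on `[0,1]` is bounded there by its supremum norm. -/
theorem abs_le_supNorm {x : ℝ → ℝ} (hx : ContinuousOn x (Icc 0 1)) {s : ℝ}
    (hs : s ∈ Icc (0:ℝ) 1) : |x s| ≤ supNorm x := by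
  have hbdd : BddAbove (range fun t : Icc (0:ℝ) 1 => |x t|) :=
    isCompact_range (continuousOn_iff_continuous_domRestrict.1 hx.abs) |>.bddAbove
  exact le_ciSup hbdd ⟨s, hs⟩

/-- The weight of the `ψ`-fractional integral on `[0,b]` is integrable, with an explicit
integral. -/
theorem integral_deriv_mul_sub_rpow {ψ : ℝ → ℝ} {a b p : ℝ} (hab : a ≤ b) (hp : 1 < p)
    (hmono : MonotoneOn ψ (Icc a b)) (hcont : ContinuousOn ψ (Icc a b))
    (hdiff : ∀ s ∈ Ioo a b, DifferentiableAt ℝ ψ s) :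
    IntervalIntegrable (fun s => deriv ψ s * (ψ b - ψ s) ^ (p - 1)) volume a b ∧
      ∫ s in a..b, deriv ψ s * (ψ b - ψ s) ^ (p - 1) = (ψ b - ψ a) ^ p / p := by
  have hGc : ContinuousOn (fun s => -((ψ b - ψ s) ^ p / p)) (Icc a b) :=
    (((continuousOn_const.sub hcont).rpow_const fun _ _ => Or.inr (by linarith)).div_const p).neg
  have hG : ∀ s ∈ Ioo a b, HasDerivAt (fun s => -((ψ b - ψ s) ^ p / p))
      (deriv ψ s * (ψ b - ψ s) ^ (p - 1)) s := fun s hs => by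
    have h := (((hdiff s hs).hasDerivAt.const_sub (ψ b)).rpow_const (p := p)
      (Or.inr hp.le)).div_const p |>.neg
    refine h.congr_deriv ?_
    have hp0 : p ≠ 0 := by linarith
    field_simp
  have hint : IntervalIntegrable (fun s => deriv ψ s * (ψ b - ψ s) ^ (p - 1)) volume a b := by
    rw [intervalIntegrable_iff_integrableOn_Ioc_of_le hab]
    refine integrableOn_deriv_of_nonneg hGc hG fun s hs => ?_
    have hs' := Ioo_subset_Icc_self hs
    refine mul_nonneg ?_ (Real.rpow_nonneg
      (sub_nonneg.2 (hmono hs' (right_mem_Icc.2 hab) hs.2.le)) _)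
    rw [← derivWithin_of_mem_nhds (Icc_mem_nhds hs.1 hs.2)]
    exact hmono.derivWithin_nonneg
  refine ⟨hint, ?_⟩
  rw [integral_eq_sub_of_hasDerivAt_of_le hab hGc hG hint, sub_self,
    Real.zero_rpow (by linarith)]
  ring

/-- The `ψ`-fractional integral of a function bounded by `K`. -/
theorem abs_integral_deriv_mul_sub_rpow_mul_le {ψ F : ℝ → ℝ} {a b p K : ℝ} (hab : a ≤ b)
    (hp : 1 < p) (hmono : MonotoneOn ψ (Icc a b)) (hcont : ContinuousOn ψ (Icc a b))
    (hdiff : ∀ s ∈ Ioo a b, DifferentiableAt ℝ ψ s) (hF : ∀ s ∈ Icc a b, |F s| ≤ K) :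
    |∫ s in a..b, deriv ψ s * (ψ b - ψ s) ^ (p - 1) * F s| ≤ (ψ b - ψ a) ^ p / p * K := by
  obtain ⟨hint, heq⟩ := integral_deriv_mul_sub_rpow hab hp hmono hcont hdiff
  rw [← heq, ← intervalIntegral.integral_mul_const, ← Real.norm_eq_abs]
  refine intervalIntegral.norm_integral_le_of_norm_le hab (.of_forall fun s hs => ?_)
    (hint.mul_const K)
  rcases hs.2.eq_or_lt with rfl | hsb
  · simp [Real.zero_rpow (by linarith : p - 1 ≠ 0)]
  · have hd : 0 ≤ deriv ψ s := by
      rw [← derivWithin_of_mem_nhds (Icc_mem_nhds hs.1 hsb)]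
      exact hmono.derivWithin_nonneg
    have hw : 0 ≤ deriv ψ s * (ψ b - ψ s) ^ (p - 1) := mul_nonneg hd (Real.rpow_nonneg
      (sub_nonneg.2 (hmono (Ioc_subset_Icc_self hs) (right_mem_Icc.2 hab) hs.2)) _)
    rw [Real.norm_eq_abs, abs_mul, abs_of_nonneg hw]
    exact mul_le_mul_of_nonneg_left (hF s (Ioc_subset_Icc_self hs)) hw

/-- If the nonlinearity is bounded by `K` along `(x, y)`, then `Tmap` is bounded by `K` times
the constant of the boundary value problem. -/
theorem supNorm_Tmap_le {ψ : ℝ → ℝ} {α η lam Δ K : ℝ} {f : ℝ → ℝ → ℝ → ℝ} {x y : ℝ → ℝ}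
    (hmono : MonotoneOn ψ (Icc 0 1)) (hψ : ContDiffOn ℝ 1 ψ (Icc 0 1)) (hα : 1 < α)
    (hη : η ∈ Icc (0:ℝ) 1) (hlam : 0 ≤ lam) (hK : ∀ s ∈ Icc (0:ℝ) 1, |f s (x s) (y s)| ≤ K) :
    supNorm (Tmap ψ α η lam Δ f x y) ≤ K / Real.Gamma (α + 1) *
      ((ψ 1 - ψ 0) ^ α + (lam + 1) / |Δ| * (ψ 1 - ψ 0) ^ (α + 1)) := by
  have h0 : (0:ℝ) ∈ Icc (0:ℝ) 1 := left_mem_Icc.2 zero_le_one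
  have h1 : (1:ℝ) ∈ Icc (0:ℝ) 1 := right_mem_Icc.2 zero_le_one
  have hK0 : 0 ≤ K := (abs_nonneg _).trans (hK 0 h0)
  have hΓ : 0 < Real.Gamma α := Real.Gamma_pos_of_pos (by linarith)
  have hα0 : 0 < α := by linarith
  have hψ01 : 0 ≤ ψ 1 - ψ 0 := sub_nonneg.2 (hmono h0 h1 zero_le_one)
  set W := ψ 1 - ψ 0
  have hI : ∀ b ∈ Icc (0:ℝ) 1,
      |∫ s in (0:ℝ)..b, deriv ψ s * (ψ b - ψ s) ^ (α - 1) * f s (x s) (y s)| ≤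
        W ^ α / α * K := fun b hb => by
    have hsub : Icc 0 b ⊆ Icc (0:ℝ) 1 := Icc_subset_Icc_right hb.2
    refine (abs_integral_deriv_mul_sub_rpow_mul_le hb.1 hα (hmono.mono hsub)
      (hψ.continuousOn.mono hsub) (fun s hs => ?_) fun s hs => hK s (hsub hs)).trans ?_
    · exact (hψ.differentiableOn one_ne_zero).differentiableAt
        (Icc_mem_nhds hs.1 (hs.2.trans_le hb.2))
    · have := hmono h0 hb hb.1
      have := hmono hb h1 hb.2
      gcongr
      linarith
  have hpow : W ^ (α + 1) = W ^ α * W := Real.rpow_add_one' hψ01 (by linarith)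
  refine ciSup_le fun ⟨t, ht⟩ => ?_
  have ht0 : 0 ≤ ψ t - ψ 0 := sub_nonneg.2 (hmono h0 ht ht.1)
  have htW : ψ t - ψ 0 ≤ W := sub_le_sub_right (hmono ht h1 ht.2) _
  set C := W ^ α / α * K with hC
  have hC0 : 0 ≤ C := (abs_nonneg _).trans (hI 0 h0)
  calc |Tmap ψ α η lam Δ f x y t|
      ≤ 1 / Real.Gamma α * C +
          1 / |Δ| * (1 / Real.Gamma α * C + lam / Real.Gamma α * C) * W := by
        refine (abs_add_le _ _).trans ?_
        rw [abs_mul, abs_mul, abs_mul, abs_of_nonneg ht0, abs_div 1 Δ, abs_one,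
          abs_of_pos (one_div_pos.2 hΓ)]
        gcongr
        · exact hI t ht
        · refine (abs_sub _ _).trans ?_
          rw [abs_mul, abs_mul, abs_of_pos (one_div_pos.2 hΓ),
            abs_of_nonneg (div_nonneg hlam hΓ.le)]
          gcongr
          · exact hI 1 h1
          · exact hI η hη
    _ = _ := by
        rw [Real.Gamma_add_one hα0.ne', hpow, hC]
        rcases eq_or_ne Δ 0 with rfl | hΔ
        · simp
          field_simp
        · field_simp
          ring

/-- A function which is Lipschitz in its last two variables is bounded along continuous
`(x, y)` in terms of their supremum norms. -/
theorem abs_apply_le_of_lipschitz {f : ℝ → ℝ → ℝ → ℝ} {L : ℝ} (hL : 0 ≤ L)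
    (hf : ContinuousOn (fun p : ℝ × ℝ × ℝ => f p.1 p.2.1 p.2.2)
      (Icc 0 1 ×ˢ (univ : Set (ℝ × ℝ))))
    (hlip : ∀ t ∈ Icc (0:ℝ) 1, ∀ x₁ y₁ x₂ y₂ : ℝ,
      |f t x₁ y₁ - f t x₂ y₂| ≤ L * (|x₁ - x₂| + |y₁ - y₂|))
    {x y : ℝ → ℝ} (hx : ContinuousOn x (Icc 0 1)) (hy : ContinuousOn y (Icc 0 1)) {s : ℝ}
    (hs : s ∈ Icc (0:ℝ) 1) :
    |f s (x s) (y s)| ≤ supNorm (fun t => f t 0 0) + L * (supNorm x + supNorm y) := by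
  have hf0 : ContinuousOn (fun t => f t 0 0) (Icc 0 1) :=
    hf.comp (f := fun t : ℝ => (t, (0:ℝ), (0:ℝ))) (by fun_prop) fun t ht => ⟨ht, mem_univ _⟩
  have h := hlip s hs (x s) (y s) 0 0
  rw [sub_zero, sub_zero] at h
  have hxy : L * (|x s| + |y s|) ≤ L * (supNorm x + supNorm y) :=
    mul_le_mul_of_nonneg_left (add_le_add (abs_le_supNorm hx hs) (abs_le_supNorm hy hs)) hL
  have h0 := abs_le_supNorm hf0 hs
  have htri := abs_add_le (f s (x s) (y s) - f s 0 0) (f s 0 0)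
  rw [sub_add_cancel] at htri
  linarith

/-- **The operator `T = (T₁,T₂)` maps the ball `B_r` into itself.**
Under (A1), if `γ₃ + γ₄ < 1` and `r ≥ (γ₁+γ₂)/(1−(γ₃+γ₄))`, then
`‖x‖+‖y‖ ≤ r` implies `‖T₁(x,y)‖ + ‖T₂(x,y)‖ ≤ r`. -/
theorem T_maps_ball_into_itself
    (α β η ξ lam μ Δ₁ Δ₂ : ℝ) (ψ : ℝ → ℝ) (f g : ℝ → ℝ → ℝ → ℝ)
    (hψmono : StrictMonoOn ψ (Icc 0 1))
    (hψC1 : ContDiffOn ℝ 1 ψ (Icc 0 1))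
    (hψ' : ∀ t ∈ Icc (0:ℝ) 1, deriv ψ t ≠ 0)
    (hα1 : 1 < α) (hα2 : α < 2) (hβ1 : 1 < β) (hβ2 : β < 2)
    (hη0 : 0 < η) (hη1 : η < 1) (hξ0 : 0 < ξ) (hξ1 : ξ < 1)
    (hlam : 0 < lam) (hμ : 0 < μ)
    (hΔ₁ : Δ₁ = lam * (ψ η - ψ 0) - (ψ 1 - ψ 0)) (hΔ₁0 : Δ₁ ≠ 0)
    (hΔ₂ : Δ₂ = μ * (ψ ξ - ψ 0) - (ψ 1 - ψ 0)) (hΔ₂0 : Δ₂ ≠ 0)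
    (hfc : ContinuousOn (fun p : ℝ × ℝ × ℝ => f p.1 p.2.1 p.2.2)
      (Icc 0 1 ×ˢ (univ : Set (ℝ × ℝ))))
    (hgc : ContinuousOn (fun p : ℝ × ℝ × ℝ => g p.1 p.2.1 p.2.2)
      (Icc 0 1 ×ˢ (univ : Set (ℝ × ℝ))))
    (L₁ L₂ : ℝ) (hL₁ : 0 < L₁) (hL₂ : 0 < L₂)
    (hflip : ∀ t ∈ Icc (0:ℝ) 1, ∀ x₁ y₁ x₂ y₂ : ℝ,
      |f t x₁ y₁ - f t x₂ y₂| ≤ L₁ * (|x₁ - x₂| + |y₁ - y₂|))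
    (hglip : ∀ t ∈ Icc (0:ℝ) 1, ∀ x₁ y₁ x₂ y₂ : ℝ,
      |g t x₁ y₁ - g t x₂ y₂| ≤ L₂ * (|x₁ - x₂| + |y₁ - y₂|))
    (M₁ M₂ γ₁ γ₂ γ₃ γ₄ : ℝ)
    (hM₁ : M₁ = ⨆ t : Set.Icc (0:ℝ) 1, |f ↑t 0 0|)
    (hM₂ : M₂ = ⨆ t : Set.Icc (0:ℝ) 1, |g ↑t 0 0|)
    (hγ₁ : γ₁ = (M₁ / Real.Gamma (α + 1)) *
      ((ψ 1 - ψ 0) ^ α + ((lam + 1) / |Δ₁|) * (ψ 1 - ψ 0) ^ (α + 1)))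
    (hγ₂ : γ₂ = (M₂ / Real.Gamma (β + 1)) *
      ((ψ 1 - ψ 0) ^ β + ((μ + 1) / |Δ₂|) * (ψ 1 - ψ 0) ^ (β + 1)))
    (hγ₃ : γ₃ = (L₁ / Real.Gamma (α + 1)) *
      ((ψ 1 - ψ 0) ^ α + ((lam + 1) / |Δ₁|) * (ψ 1 - ψ 0) ^ (α + 1)))
    (hγ₄ : γ₄ = (L₂ / Real.Gamma (β + 1)) *
      ((ψ 1 - ψ 0) ^ β + ((μ + 1) / |Δ₂|) * (ψ 1 - ψ 0) ^ (β + 1)))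
    (hcontr : γ₃ + γ₄ < 1)
    (r : ℝ) (hr : r ≥ (γ₁ + γ₂) / (1 - (γ₃ + γ₄))) :
    ∀ x y : ℝ → ℝ,
      ContinuousOn x (Icc 0 1) → ContinuousOn y (Icc 0 1) →
      supNorm x + supNorm y ≤ r →
      supNorm (Tmap ψ α η lam Δ₁ f x y) + supNorm (Tmap ψ β ξ μ Δ₂ g x y) ≤ r := by
  intro x y hx hy hxy
  have hT₁ : supNorm (Tmap ψ α η lam Δ₁ f x y) ≤ γ₁ + γ₃ * r := by
    rw [hγ₁, hγ₃]
    refine (supNorm_Tmap_le (K := M₁ + L₁ * r) hψmono.monotoneOn hψC1 hα1 ⟨hη0.le, hη1.le⟩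
      hlam.le fun s hs => ?_).trans_eq (by ring)
    refine (abs_apply_le_of_lipschitz hL₁.le hfc hflip hx hy hs).trans ?_
    rw [hM₁]
    exact add_le_add le_rfl (mul_le_mul_of_nonneg_left hxy hL₁.le)
  have hT₂ : supNorm (Tmap ψ β ξ μ Δ₂ g x y) ≤ γ₂ + γ₄ * r := by
    rw [hγ₂, hγ₄]
    refine (supNorm_Tmap_le (K := M₂ + L₂ * r) hψmono.monotoneOn hψC1 hβ1 ⟨hξ0.le, hξ1.le⟩
      hμ.le fun s hs => ?_).trans_eq (by ring)
    refine (abs_apply_le_of_lipschitz hL₂.le hgc hglip hx hy hs).trans ?_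
    rw [hM₂]
    exact add_le_add le_rfl (mul_le_mul_of_nonneg_left hxy hL₂.le)
  have hr' := (div_le_iff₀ (sub_pos.2 hcontr)).1 hr
  linarith
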